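/- Let T_A denote the acyclic (transitive) tournament on 3 vertices. Then n^{-5/9} is the threshold probability for the unbiased T_A-tournament game on the random graph G_{n,p}: if p = p(n) satisfies p(n)·n^{5/9} → ∞ as n → ∞, then asymptotically almost surely Maker has a winning strategy in the unbiased T_A-tournament game on G_{n,p}, and if p(n)·n^{5/9} → 0, then asymptotically almost surely Breaker has a winning strategy. -/

import Mathlib

namespace TournamentGame

variable {V : Type*} [DecidableEq V]

/-- The underlying undirected edges of a set of oriented edges. -/
def undirect (M : Finset (V × V)) : Finset (Sym2 V) :=
  M.image fun p => s(p.1, p.2)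

/-- `MakerWin X F b M B` : in the (1:b) Maker-Breaker game on board `X`, with Maker
having claimed `M`, Breaker having claimed `B`, and Maker to move, Maker has a strategy
to claim all edges of some winning set (i.e. reach a position with `F` on her edges). -/
inductive MakerWin (X : Finset (Sym2 V)) (F : Finset (Sym2 V) → Prop) (b : ℕ) :
    Finset (Sym2 V) → Finset (Sym2 V) → Prop
  | win (M B : Finset (Sym2 V)) : F M → MakerWin X F b M B
  | move (M B : Finset (Sym2 V)) (e : Sym2 V) (heX : e ∈ X) (hefree : e ∉ M ∪ B)
      (h : ∀ B' : Finset (Sym2 V), B' ⊆ X \ (insert e M ∪ B) →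
        B'.card = min b (X \ (insert e M ∪ B)).card →
        MakerWin X F b (insert e M) (B ∪ B')) :
      MakerWin X F b M B

/-- `BreakerBlock X F b M B` : Maker to move; Breaker has a strategy ensuring that `F`
never holds on Maker's edge set. -/
inductive BreakerBlock (X : Finset (Sym2 V)) (F : Finset (Sym2 V) → Prop) (b : ℕ) :
    Finset (Sym2 V) → Finset (Sym2 V) → Prop
  | step (M B : Finset (Sym2 V)) (hF : ¬ F M) (resp : Sym2 V → Finset (Sym2 V))
      (hsub : ∀ e ∈ X, e ∉ M ∪ B → resp e ⊆ X \ (insert e M ∪ B))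
      (hcard : ∀ e ∈ X, e ∉ M ∪ B → (resp e).card = min b (X \ (insert e M ∪ B)).card)
      (h : ∀ e ∈ X, e ∉ M ∪ B → BreakerBlock X F b (insert e M) (B ∪ resp e)) :
      BreakerBlock X F b M B

/-- Oriented (tournament-game) version of `MakerWin`: Maker claims an edge together with
an orientation; her position is a set of oriented edges. -/
inductive OMakerWin (X : Finset (Sym2 V)) (F : Finset (V × V) → Prop) (b : ℕ) :
    Finset (V × V) → Finset (Sym2 V) → Prop
  | win (M : Finset (V × V)) (B : Finset (Sym2 V)) : F M → OMakerWin X F b M B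
  | move (M : Finset (V × V)) (B : Finset (Sym2 V)) (x y : V)
      (heX : s(x, y) ∈ X) (hefree : s(x, y) ∉ undirect M ∪ B)
      (h : ∀ B' : Finset (Sym2 V), B' ⊆ X \ (insert s(x, y) (undirect M) ∪ B) →
        B'.card = min b (X \ (insert s(x, y) (undirect M) ∪ B)).card →
        OMakerWin X F b (insert (x, y) M) (B ∪ B')) :
      OMakerWin X F b M B

/-- Oriented version of `BreakerBlock`. -/
inductive OBreakerBlock (X : Finset (Sym2 V)) (F : Finset (V × V) → Prop) (b : ℕ) :
    Finset (V × V) → Finset (Sym2 V) → Prop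
  | step (M : Finset (V × V)) (B : Finset (Sym2 V)) (hF : ¬ F M)
      (resp : V → V → Finset (Sym2 V))
      (hsub : ∀ x y : V, s(x, y) ∈ X → s(x, y) ∉ undirect M ∪ B →
        resp x y ⊆ X \ (insert s(x, y) (undirect M) ∪ B))
      (hcard : ∀ x y : V, s(x, y) ∈ X → s(x, y) ∉ undirect M ∪ B →
        (resp x y).card = min b (X \ (insert s(x, y) (undirect M) ∪ B)).card)
      (h : ∀ x y : V, s(x, y) ∈ X → s(x, y) ∉ undirect M ∪ B →
        OBreakerBlock X F b (insert (x, y) M) (B ∪ resp x y)) :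
      OBreakerBlock X F b M B

/-- Position with Breaker to move, in the unoriented game: Breaker can respond and
then keep blocking forever. -/
def BreakerTurn (X : Finset (Sym2 V)) (F : Finset (Sym2 V) → Prop) (b : ℕ)
    (M B : Finset (Sym2 V)) : Prop :=
  ¬ F M ∧ ∃ B' : Finset (Sym2 V), B' ⊆ X \ (M ∪ B) ∧
    B'.card = min b (X \ (M ∪ B)).card ∧ BreakerBlock X F b M (B ∪ B')

/-- Position with Breaker to move, in the oriented game. -/
def OBreakerTurn (X : Finset (Sym2 V)) (F : Finset (V × V) → Prop) (b : ℕ)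
    (M : Finset (V × V)) (B : Finset (Sym2 V)) : Prop :=
  ¬ F M ∧ ∃ B' : Finset (Sym2 V), B' ⊆ X \ (undirect M ∪ B) ∧
    B'.card = min b (X \ (undirect M ∪ B)).card ∧ OBreakerBlock X F b M (B ∪ B')

/-- Winning sets of the triangle game. -/
def HasTriangle (M : Finset (Sym2 V)) : Prop :=
  ∃ x y z : V, x ≠ y ∧ y ≠ z ∧ x ≠ z ∧ s(x, y) ∈ M ∧ s(y, z) ∈ M ∧ s(x, z) ∈ M

/-- Maker's oriented edges contain a cyclic (directed) triangle. -/
def HasCyclicTriangle (M : Finset (V × V)) : Prop :=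
  ∃ x y z : V, x ≠ y ∧ y ≠ z ∧ x ≠ z ∧ (x, y) ∈ M ∧ (y, z) ∈ M ∧ (z, x) ∈ M

/-- Maker's oriented edges contain an acyclic (transitive) triangle. -/
def HasAcyclicTriangle (M : Finset (V × V)) : Prop :=
  ∃ x y z : V, x ≠ y ∧ y ≠ z ∧ x ≠ z ∧ (x, y) ∈ M ∧ (y, z) ∈ M ∧ (x, z) ∈ M

/-- A tournament on `Fin k`, given by its arc relation. -/
def IsTournament {k : ℕ} (T : Fin k → Fin k → Prop) : Prop :=
  (∀ i, ¬ T i i) ∧ ∀ i j : Fin k, i ≠ j → (T i j ↔ ¬ T j i)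

/-- Maker's oriented edges contain a copy of the tournament `T`. -/
def HasTCopy {k : ℕ} (T : Fin k → Fin k → Prop) (M : Finset (V × V)) : Prop :=
  ∃ f : Fin k → V, Function.Injective f ∧ ∀ i j : Fin k, T i j → (f i, f j) ∈ M

/-- The edge set of the complete graph `K_n`. -/
def completeEdges (n : ℕ) : Finset (Sym2 (Fin n)) :=
  Finset.univ.filter fun e => ¬ e.IsDiag

/-- The edge set of the Turán graph `T_{n,k}` : classes are residues mod `k`. -/
def turanEdges (n k : ℕ) : Finset (Sym2 (Fin n)) :=
  Finset.univ.filter fun e => ¬ (e.map fun v : Fin n => v.val % k).IsDiag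

/-- `A` contains a good copy of `K_k` (all vertices in distinct classes of `T_{n,k}`). -/
def GoodCopy (n k : ℕ) (A : Finset (Sym2 (Fin n))) : Prop :=
  ∃ f : Fin k → Fin n, Function.Injective f ∧
    (∀ i j : Fin k, i ≠ j → (f i).val % k ≠ (f j).val % k) ∧
    (∀ i j : Fin k, i ≠ j → s(f i, f j) ∈ A)

open Classical in
/-- Probability that a `p`-random subset `A` of `E` (each element kept independently with
probability `p`) satisfies `P`. This is the model `G(E, p)`. -/
noncomputable def edgeProb {α : Type*} [DecidableEq α] (E : Finset α) (p : ℝ)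
    (P : Finset α → Prop) : ℝ :=
  ∑ A ∈ E.powerset, if P A then p ^ A.card * (1 - p) ^ (E.card - A.card) else 0

open Classical in
/-- Probability that a uniformly random `M`-element subset of `E` satisfies `P`.
This is the model `G(E, M)`. -/
noncomputable def uniformProb {α : Type*} [DecidableEq α] (E : Finset α) (M : ℕ)
    (P : Finset α → Prop) : ℝ :=
  ((E.powerset.filter fun A => A.card = M ∧ P A).card : ℝ) /
    ((E.powerset.filter fun A => A.card = M).card : ℝ)

/-- The three edges of a triangle on `x`, `y`, `z`. -/
def triEdges (x y z : V) : Finset (Sym2 V) := {s(x, y), s(y, z), s(x, z)}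

/-- `x`, `y`, `z` form a triangle of the graph with edge set `A`. -/
def IsTriangleIn (A : Finset (Sym2 V)) (x y z : V) : Prop :=
  x ≠ y ∧ y ≠ z ∧ x ≠ z ∧ s(x, y) ∈ A ∧ s(y, z) ∈ A ∧ s(x, z) ∈ A

/-- The triangles of `A`, each recorded as its set of three edges: the vertex set of `T_A`. -/
def TriSets (A : Finset (Sym2 V)) : Set (Finset (Sym2 V)) :=
  {t | ∃ x y z : V, IsTriangleIn A x y z ∧ t = triEdges x y z}

/-- `C` is a triangle collection: every edge lies in a triangle and the graph `T_C` of
triangles (adjacent iff sharing an edge) is connected. -/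
def IsTriangleCollection (C : Finset (Sym2 V)) : Prop :=
  (∀ e ∈ C, ∃ x y z : V, IsTriangleIn C x y z ∧ e ∈ triEdges x y z) ∧
  ∀ t ∈ TriSets C, ∀ t' ∈ TriSets C,
    Relation.ReflTransGen
      (fun a b => a ∈ TriSets C ∧ b ∈ TriSets C ∧ (a ∩ b).Nonempty) t t'

/-- Adjacency of `K₃⁺`: a triangle on `{0,1,2}` with a pendant edge `{2,3}`. -/
def K3plusAdj (a b : Fin 4) : Prop :=
  (a.val < 3 ∧ b.val < 3 ∧ a ≠ b) ∨ (a.val = 2 ∧ b.val = 3) ∨ (a.val = 3 ∧ b.val = 2)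

/-- Adjacency of the path on `Fin m`. -/
def pathAdj {m : ℕ} (a b : Fin m) : Prop := a.val + 1 = b.val ∨ b.val + 1 = a.val

/-- `C` is very basic: `T_C` is (isomorphic to) a subgraph of `K₃⁺` or of a path `P_m`. -/
def VeryBasic (C : Finset (Sym2 V)) : Prop :=
  (∃ φ : TriSets C → Fin 4, Function.Injective φ ∧
    ∀ t t' : TriSets C, t ≠ t' → ((t : Finset (Sym2 V)) ∩ (t' : Finset (Sym2 V))).Nonempty →
      K3plusAdj (φ t) (φ t')) ∨
  (∃ m : ℕ, ∃ φ : TriSets C → Fin m, Function.Injective φ ∧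
    ∀ t t' : TriSets C, t ≠ t' → ((t : Finset (Sym2 V)) ∩ (t' : Finset (Sym2 V))).Nonempty →
      pathAdj (φ t) (φ t'))

/-- `C` is basic: there are distinct edges `e₁, e₂` with `C - eᵢ` very basic for both. -/
def Basic (C : Finset (Sym2 V)) : Prop :=
  ∃ e₁ ∈ C, ∃ e₂ ∈ C, e₁ ≠ e₂ ∧ VeryBasic (C.erase e₁) ∧ VeryBasic (C.erase e₂)

open Classical in
/-- The set of non-isolated vertices of the graph with edge set `C`. -/
noncomputable def support [Fintype V] (C : Finset (Sym2 V)) : Finset V :=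
  Finset.univ.filter fun v => ∃ e ∈ C, v ∈ e

open Classical in
/-- Degree of `v` in the graph with edge set `C`. -/
noncomputable def degreeIn (C : Finset (Sym2 V)) (v : V) : ℕ :=
  (C.filter fun e => v ∈ e).card

/-- The maximum density `m(C) = max_{H ⊆ C} e(H)/v(H)` is (strictly) less than `r`. -/
def MaxDensityLt [Fintype V] (C : Finset (Sym2 V)) (r : ℝ) : Prop :=
  ∀ D ⊆ C, D.Nonempty → (D.card : ℝ) / ((support D).card : ℝ) < r

/-- The edge set of the `k`-wheel: a cycle on `{0, …, k-1} ⊆ Fin (k+1)` together with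
all edges to the center, the vertex `k`. -/
def wheelEdges (k : ℕ) : Finset (Sym2 (Fin (k + 1))) :=
  ((Finset.univ : Finset (Fin k)).image fun i =>
    s((⟨i.val, by have := i.2; omega⟩ : Fin (k + 1)),
      (⟨(i.val + 1) % k, by have := i.2; exact Nat.lt_succ_of_lt (Nat.mod_lt _ (by omega))⟩ :
        Fin (k + 1)))) ∪
  ((Finset.univ : Finset (Fin k)).image fun i =>
    s((⟨i.val, by have := i.2; omega⟩ : Fin (k + 1)), (Fin.last k)))

lemma undirect_insert (x y : V) (M : Finset (V × V)) :
    undirect (insert (x, y) M) = insert s(x, y) (undirect M) := by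
  simp [undirect, Finset.image_insert]

lemma mem_undirect {x y : V} {M : Finset (V × V)} :
    s(x, y) ∈ undirect M ↔ (x, y) ∈ M ∨ (y, x) ∈ M := by
  simp only [undirect, Finset.mem_image, Prod.exists, Sym2.eq_iff]
  constructor
  · rintro ⟨a, b, h, ⟨rfl, rfl⟩ | ⟨rfl, rfl⟩⟩
    · exact Or.inl h
    · exact Or.inr h
  · rintro (h | h)
    · exact ⟨x, y, h, by simp⟩
    · exact ⟨y, x, h, by simp⟩

/-! ### Maker's side of the game -/

/-- Two Maker edges at a common vertex extend to an acyclic triangle whatever their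
orientations are. -/
lemma OMakerWin.of_threat {X : Finset (Sym2 V)} {b : ℕ} {M : Finset (V × V)}
    {B : Finset (Sym2 V)} {x y z : V} (hxy : x ≠ y) (hyz : y ≠ z) (hxz : x ≠ z)
    (h₁ : s(x, y) ∈ undirect M) (h₂ : s(y, z) ∈ undirect M) (h₃ : s(x, z) ∈ X)
    (h₄ : s(x, z) ∉ undirect M ∪ B) : OMakerWin X HasAcyclicTriangle b M B := by
  have hzx : s(z, x) = s(x, z) := Sym2.eq_swap
  rcases mem_undirect.1 h₁ with h₁ | h₁ <;> rcases mem_undirect.1 h₂ with h₂ | h₂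
  · exact .move M B x z h₃ h₄ fun B' _ _ =>
      .win _ _ ⟨x, y, z, hxy, hyz, hxz, by simp [h₁], by simp [h₂], by simp⟩
  · exact .move M B x z h₃ h₄ fun B' _ _ =>
      .win _ _ ⟨x, z, y, hxz, hyz.symm, hxy, by simp, by simp [h₂], by simp [h₁]⟩
  · exact .move M B x z h₃ h₄ fun B' _ _ =>
      .win _ _ ⟨y, x, z, hxy.symm, hxz, hyz, by simp [h₁], by simp, by simp [h₂]⟩
  · exact .move M B z x (hzx ▸ h₃) (hzx ▸ h₄) fun B' _ _ =>
      .win _ _ ⟨z, y, x, hyz.symm, hxy.symm, hxz.symm, by simp [h₂], by simp [h₁], by simp⟩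

/-- Claiming `xz` next to an own edge `xy` forces Breaker to answer with `yz`. -/
lemma OMakerWin.of_force {X : Finset (Sym2 V)} {M : Finset (V × V)}
    {B : Finset (Sym2 V)} {x y z : V} (hxy : x ≠ y) (hyz : y ≠ z) (hxz : x ≠ z)
    (h₁ : s(x, y) ∈ undirect M) (h₂ : s(x, z) ∈ X) (h₃ : s(x, z) ∉ undirect M ∪ B)
    (h₄ : s(y, z) ∈ X) (h₅ : s(y, z) ∉ undirect M ∪ B)
    (h : OMakerWin X HasAcyclicTriangle 1 (insert (x, z) M) (B ∪ {s(y, z)})) :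
    OMakerWin X HasAcyclicTriangle 1 M B := by
  refine .move M B x z h₂ h₃ fun B' hB' hcard => ?_
  by_cases hyzB : s(y, z) ∈ B'
  · have hle : B'.card ≤ 1 := hcard ▸ min_le_left _ _
    have : B' = {s(y, z)} :=
      Finset.eq_singleton_iff_unique_mem.2 ⟨hyzB, fun g hg =>
        Finset.card_le_one.1 hle g hg _ hyzB⟩
    exact this ▸ h
  · refine .of_threat hxy.symm hxz hyz (b := 1) (by simp [undirect_insert, Sym2.eq_swap, h₁])
      (by simp [undirect_insert]) h₄ ?_
    rw [undirect_insert]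
    simp only [Finset.mem_union, not_or] at h₅
    simp only [Finset.mem_union, Finset.mem_insert, not_or]
    refine ⟨⟨?_, h₅.1⟩, h₅.2, hyzB⟩
    simp [hxy.symm, hyz]

lemma OMakerWin.of_fan_three {X : Finset (Sym2 V)} {M : Finset (V × V)}
    {B : Finset (Sym2 V)} {a b c u : V} (hd : [a, b, c, u].Nodup)
    (hab : s(a, b) ∈ undirect M)
    (hX : ∀ e ∈ [s(a, c), s(b, c), s(a, u), s(b, u), s(c, u)], e ∈ X ∧ e ∉ undirect M ∪ B) :
    OMakerWin X HasAcyclicTriangle 1 M B := by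
  have hr := List.nodup_reverse.2 hd
  simp only [List.reverse_cons, List.reverse_nil, List.nil_append, List.cons_append,
    List.nodup_cons, List.mem_cons, List.not_mem_nil, or_false, not_or,
    List.nodup_nil, not_false_eq_true, and_true] at hd hr
  obtain ⟨⟨h₁, h₂, h₃⟩, ⟨h₄, h₅⟩, h₆⟩ := hd
  simp only [List.forall_mem_cons, Finset.mem_union, not_or, List.not_mem_nil,
    false_implies, implies_true, and_true] at hX
  refine .of_force (x := a) (y := b) (z := c) h₁ h₄ h₂ hab hX.1.1 (by simp [hX])
    hX.2.1.1 (by simp [hX]) ?_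
  refine .of_force (x := a) (y := b) (z := u) h₁ h₅ h₃ ?_ ?_ ?_ ?_ ?_ ?_ <;>
    simp [undirect_insert, *]
  refine .of_threat (x := c) (y := a) (z := u) (Ne.symm h₂) h₃ h₆ ?_ ?_ ?_ ?_ <;>
    simp [undirect_insert, *]

lemma OMakerWin.of_fan_four {X : Finset (Sym2 V)} {M : Finset (V × V)}
    {B : Finset (Sym2 V)} {a b c u v : V} (hd : [a, b, c, u, v].Nodup)
    (hab : s(a, b) ∈ undirect M)
    (hX : ∀ e ∈ [s(a, c), s(a, u), s(b, u), s(u, c), s(a, v), s(b, v), s(c, v)],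
      e ∈ X ∧ e ∉ undirect M ∪ B) :
    OMakerWin X HasAcyclicTriangle 1 M B := by
  have hr := List.nodup_reverse.2 hd
  simp only [List.reverse_cons, List.reverse_nil, List.nil_append, List.cons_append,
    List.nodup_cons, List.mem_cons, List.not_mem_nil, or_false, not_or,
    List.nodup_nil, not_false_eq_true, and_true] at hd hr
  obtain ⟨⟨h₁, h₂, h₃, h₇⟩, ⟨h₄, h₅, h₈⟩, ⟨h₆, h₉⟩, h₀⟩ := hd
  simp only [List.forall_mem_cons, Finset.mem_union, not_or, List.not_mem_nil,
    false_implies, implies_true, and_true] at hX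
  refine .of_force (x := a) (y := b) (z := u) h₁ h₅ h₃ hab hX.2.1.1 (by simp [hX])
    hX.2.2.1.1 (by simp [hX]) ?_
  refine .of_force (x := a) (y := u) (z := c) h₃ (Ne.symm h₆) h₂ ?_ ?_ ?_ ?_ ?_ ?_ <;>
    simp [undirect_insert, *]
  refine .of_force (x := a) (y := b) (z := v) h₁ h₈ h₇ ?_ ?_ ?_ ?_ ?_ ?_ <;>
    simp [undirect_insert, *]
  refine .of_threat (x := c) (y := a) (z := v) (Ne.symm h₂) h₇ h₉ ?_ ?_ ?_ ?_ <;>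
    simp [undirect_insert, *]

/-- Maker wins the acyclic triangle game on any board containing `K₅` minus an edge. -/
lemma oMakerWin_of_K5_minus_edge {X : Finset (Sym2 V)} {a b c u v : V}
    (hd : [a, b, c, u, v].Nodup)
    (hX : ∀ e ∈ [s(a, b), s(a, c), s(b, c), s(a, u), s(b, u), s(c, u),
      s(a, v), s(b, v), s(c, v)], e ∈ X) :
    OMakerWin X HasAcyclicTriangle 1 ∅ ∅ := by
  have hd' := hd
  have hr := List.nodup_reverse.2 hd
  simp only [List.reverse_cons, List.reverse_nil, List.nil_append, List.cons_append,
    List.nodup_cons, List.mem_cons, List.not_mem_nil, or_false, not_or,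
    List.nodup_nil, not_false_eq_true, and_true] at hd' hr
  obtain ⟨⟨h₁, h₂, h₃, h₇⟩, ⟨h₄, h₅, h₈⟩, ⟨h₆, h₉⟩, h₀⟩ := hd'
  simp only [List.forall_mem_cons, List.not_mem_nil,
    false_implies, implies_true, and_true] at hX
  obtain ⟨hab, hac, hbc, hau, hbu, hcu, hav, hbv, hcv⟩ := hX
  refine .move ∅ ∅ a b hab (by simp [undirect]) fun B' _ hcard => ?_
  have hone : ∀ g ∈ B', ∀ h ∈ B', g = h :=
    fun g hg h hh => Finset.card_le_one.1 (hcard ▸ min_le_left _ _) g hg h hh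
  have hU : undirect (insert (a, b) (∅ : Finset (V × V))) = {s(a, b)} := by simp [undirect]
  have huc : s(u, c) ∈ X := Sym2.eq_swap (a := c) (b := u) ▸ hcu
  by_cases ebc : s(b, c) ∈ B'
  · have hf : ∀ g, g ≠ s(b, c) → g ∉ B' := fun g hg h => hg (hone _ h _ ebc)
    refine .of_fan_four hd (by rw [hU]; simp) ?_
    simp only [List.forall_mem_cons, hU]
    simp [*]
  by_cases eac : s(a, c) ∈ B'
  · have hf : ∀ g, g ≠ s(a, c) → g ∉ B' := fun g hg h => hg (hone _ h _ eac)
    refine .of_fan_four (a := b) (b := a) (c := c) (u := u) (v := v) ?_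
      (by rw [hU, Sym2.eq_swap]; simp) ?_
    · simp [*]
    simp only [List.forall_mem_cons, hU]
    simp [*]
  by_cases hu : s(a, u) ∉ B' ∧ s(b, u) ∉ B' ∧ s(c, u) ∉ B'
  · obtain ⟨k₁, k₂, k₃⟩ := hu
    refine .of_fan_three (a := a) (b := b) (c := c) (u := u) ?_ (by rw [hU]; simp) ?_
    · simp [*]
    simp only [List.forall_mem_cons, hU]
    simp [*]
  · have hf : s(a, v) ∉ B' ∧ s(b, v) ∉ B' ∧ s(c, v) ∉ B' := by
      by_contra hcon
      have : ∃ p q, s(p, u) ∈ B' ∧ s(q, v) ∈ B' ∧ p ≠ v := by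
        simp only [not_and_or, not_not] at hu hcon
        rcases hu with h | h | h <;> rcases hcon with h' | h' | h' <;>
          exact ⟨_, _, h, h', by assumption⟩
      obtain ⟨p, q, hp, hq, hpv⟩ := this
      have := hone _ hp _ hq
      rw [Sym2.eq_iff] at this
      tauto
    obtain ⟨k₁, k₂, k₃⟩ := hf
    refine .of_fan_three (a := a) (b := b) (c := c) (u := v) ?_ (by rw [hU]; simp) ?_
    · simp [*]
    simp only [List.forall_mem_cons, hU]
    simp [*]

/-! ### Breaker's side of the game -/

/-- Two edges are linked if they lie in a common triangle of `X`. -/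
def Linked (X : Finset (Sym2 V)) (e e' : Sym2 V) : Prop :=
  ∃ x y z : V, IsTriangleIn X x y z ∧ e ∈ triEdges x y z ∧ e' ∈ triEdges x y z

open Classical in
/-- The edges of `X` reachable from `e` through triangles of `X`. -/
noncomputable def triComponent (X : Finset (Sym2 V)) (e : Sym2 V) : Finset (Sym2 V) :=
  X.filter fun e' => Relation.ReflTransGen (Linked X) e e'

lemma mem_triComponent {X : Finset (Sym2 V)} {e g : Sym2 V} :
    g ∈ triComponent X e ↔ g ∈ X ∧ Relation.ReflTransGen (Linked X) e g := by
  simp [triComponent]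

lemma triComponent_subset (X : Finset (Sym2 V)) (e : Sym2 V) : triComponent X e ⊆ X :=
  fun _ h => (mem_triComponent.1 h).1

lemma Linked.reflTransGen_symm {X : Finset (Sym2 V)} {e g : Sym2 V}
    (h : Relation.ReflTransGen (Linked X) e g) : Relation.ReflTransGen (Linked X) g e :=
  have : Std.Symm (Linked X) := ⟨fun _ _ ⟨x, y, z, h, h₁, h₂⟩ => ⟨x, y, z, h, h₂, h₁⟩⟩
  Relation.ReflTransGen.stdSymm.symm _ _ h

lemma triComponent_eq {X : Finset (Sym2 V)} {e g : Sym2 V} (h : g ∈ triComponent X e) :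
    triComponent X g = triComponent X e := by
  have h := (mem_triComponent.1 h).2
  ext k
  simp only [mem_triComponent, and_congr_right_iff]
  exact fun _ => ⟨h.trans, (Linked.reflTransGen_symm h).trans⟩

/-- The unclaimed-by-Breaker edges of `C` can be grouped into pairs so that every triangle
of `C` still alive contains a pair without Maker edges (`U` being Maker's edges). -/
def Paired (C U B : Finset (Sym2 V)) : Prop :=
  ∃ c : Sym2 V → V, (∀ u, ((C \ B).filter fun g => c g = u).card ≤ 2) ∧
    ∀ x y z, IsTriangleIn (C \ B) x y z → ∃ g ∈ triEdges x y z, ∃ g' ∈ triEdges x y z,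
      g ≠ g' ∧ c g = c g' ∧ g ∉ U ∧ g' ∉ U

omit [DecidableEq V] in
lemma IsTriangleIn.mono {A A' : Finset (Sym2 V)} (h : A ⊆ A') {x y z : V}
    (ht : IsTriangleIn A x y z) : IsTriangleIn A' x y z :=
  ⟨ht.1, ht.2.1, ht.2.2.1, h ht.2.2.2.1, h ht.2.2.2.2.1, h ht.2.2.2.2.2⟩

lemma IsTriangleIn.triEdges_subset {A : Finset (Sym2 V)} {x y z : V}
    (ht : IsTriangleIn A x y z) : triEdges x y z ⊆ A := by
  obtain ⟨-, -, -, h₁, h₂, h₃⟩ := ht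
  intro g hg
  simp only [triEdges, Finset.mem_insert, Finset.mem_singleton] at hg
  rcases hg with rfl | rfl | rfl <;> assumption

lemma Paired.mono {C U B U' B' : Finset (Sym2 V)} (h : Paired C U B)
    (hU : ∀ g ∈ C, g ∈ U' → g ∈ U) (hB : C \ B' ⊆ C \ B) : Paired C U' B' := by
  obtain ⟨c, hc, ht⟩ := h
  refine ⟨c, fun u => (Finset.card_le_card (Finset.filter_subset_filter _ hB)).trans (hc u), ?_⟩
  intro x y z hxyz
  obtain ⟨g, hg, g', hg', hne, hcg, h₁, h₂⟩ := ht x y z (hxyz.mono hB)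
  have hs := hxyz.triEdges_subset
  exact ⟨g, hg, g', hg', hne, hcg, fun h => h₁ (hU g (Finset.mem_sdiff.1 (hs hg)).1 h),
    fun h => h₂ (hU g' (Finset.mem_sdiff.1 (hs hg')).1 h)⟩

/-- Breaker's answer to a Maker edge in a component where he follows a pairing. -/
lemma Paired.exists_answer {C U B : Finset (Sym2 V)} (h : Paired C U B) {e : Sym2 V}
    (heC : e ∈ C) (heB : e ∉ B) :
    ∃ f, ∀ B', (f ∈ C → f ∉ insert e U ∪ B → f ∈ B') →
      Paired C (insert e U) (B ∪ B') := by
  obtain ⟨c, hc, ht⟩ := h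
  have key : ∀ g ∈ C \ B, g ≠ e → c g = c e → ∀ g' ∈ C \ B, g' ≠ e → c g' = c e → g = g' := by
    intro g hg hge hgc g' hg' hge' hgc'
    by_contra hne
    have h3 : ({e, g, g'} : Finset (Sym2 V)).card = 3 :=
      Finset.card_eq_three.2 ⟨e, g, g', hge.symm, hge'.symm, hne, rfl⟩
    have : ({e, g, g'} : Finset (Sym2 V)) ⊆ (C \ B).filter fun k => c k = c e := by
      intro k hk
      simp only [Finset.mem_insert, Finset.mem_singleton] at hk
      rcases hk with rfl | rfl | rfl <;> simp_all
    have := Finset.card_le_card this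
    have := hc (c e)
    omega
  have main : ∃ f, ∀ g ∈ C \ B, g ≠ e → c g = c e → g = f := by
    by_cases hex : ∃ g ∈ C \ B, g ≠ e ∧ c g = c e
    · obtain ⟨f, hf, hfe, hfc⟩ := hex
      exact ⟨f, fun g hg hge hgc => key g hg hge hgc f hf hfe hfc⟩
    · push Not at hex
      exact ⟨e, fun g hg hge hgc => absurd hgc (hex g hg hge)⟩
  obtain ⟨f, hf⟩ := main
  refine ⟨f, fun B' hB' => ?_⟩
  have hsub : C \ (B ∪ B') ⊆ C \ B := Finset.sdiff_subset_sdiff le_rfl Finset.subset_union_left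
  refine ⟨c, fun u => (Finset.card_le_card (Finset.filter_subset_filter _ hsub)).trans (hc u), ?_⟩
  intro x y z hxyz
  obtain ⟨g, hg, g', hg', hne, hcg, h₁, h₂⟩ := ht x y z (hxyz.mono hsub)
  have hs := hxyz.triEdges_subset
  have claim : ∀ k ∈ triEdges x y z, k ∉ U → c k = c e → k = e := by
    intro k hk hkU hkc
    by_contra hke
    have hk' := hs hk
    have : k = f := hf k (hsub hk') hke hkc
    subst this
    simp only [Finset.mem_sdiff, Finset.mem_union, not_or] at hk'
    exact hk'.2.2 (hB' hk'.1 (by simp [hke, hkU, hk'.2.1]))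
  refine ⟨g, hg, g', hg', hne, hcg, ?_, ?_⟩
  · rw [Finset.mem_insert, not_or]
    exact ⟨fun h => hne (h.trans (claim g' hg' h₂ (by rw [← hcg, h])).symm), h₁⟩
  · rw [Finset.mem_insert, not_or]
    exact ⟨fun h => hne ((claim g hg h₁ (by rw [hcg, h])).trans h.symm), h₂⟩

/-- Vertex sets obtained from `{x, z}` by repeatedly adding a vertex with at least two
`C`-neighbours in the set. -/
inductive Grown (C : Finset (Sym2 V)) (x z : V) : Finset V → Prop
  | base : Grown C x z {x, z}
  | step (S : Finset V) (u a b : V) : Grown C x z S → u ∉ S → a ∈ S → b ∈ S → a ≠ b →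
      s(u, a) ∈ C → s(u, b) ∈ C → Grown C x z (insert u S)

lemma Grown.mem {C : Finset (Sym2 V)} {x z : V} {S : Finset V} (h : Grown C x z S) :
    x ∈ S ∧ z ∈ S := by
  induction h with
  | base => simp
  | step S u a b _ _ _ _ _ _ _ ih => exact ⟨by simp [ih.1], by simp [ih.2]⟩

lemma mem_triEdges_of_mem {x y z u : V} (hxy : x ≠ y) (hyz : y ≠ z) (hxz : x ≠ z)
    (hu : u = x ∨ u = y ∨ u = z) :
    ∃ g ∈ triEdges x y z, ∃ g' ∈ triEdges x y z, g ≠ g' ∧ u ∈ g ∧ u ∈ g' := by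
  rcases hu with rfl | rfl | rfl
  · exact ⟨s(u, y), by simp [triEdges], s(u, z), by simp [triEdges],
      by simp [hyz, hxz], by simp, by simp⟩
  · exact ⟨s(x, u), by simp [triEdges], s(u, z), by simp [triEdges],
      by simp [hyz, hxy, hxz], by simp, by simp⟩
  · exact ⟨s(y, u), by simp [triEdges], s(x, u), by simp [triEdges],
      by simp [hyz, hxy.symm], by simp, by simp⟩

/-- The order in which a set is grown yields a pairing once few surplus edges are deleted. -/
lemma Grown.exists_pairing {C : Finset (Sym2 V)} {x z : V} {S : Finset V}
    (h : Grown C x z S) (hxz : x ≠ z) (hC : s(x, z) ∈ C) (hdiag : ∀ e ∈ C, ¬ e.IsDiag) :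
    ∃ (c : Sym2 V → V) (F : Finset (Sym2 V)), s(x, z) ∉ F ∧
      F.card + 2 * S.card ≤ (C ∩ S.sym2).card + 3 ∧
      (∀ g ∈ C ∩ S.sym2, c g ∈ S) ∧
      (∀ u, (((C ∩ S.sym2) \ F).filter fun g => c g = u).card ≤ 2) ∧
      ∀ p q r, IsTriangleIn ((C ∩ S.sym2) \ F) p q r →
        ∃ g ∈ triEdges p q r, ∃ g' ∈ triEdges p q r,
          g ≠ g' ∧ c g = c g' ∧ g ≠ s(x, z) ∧ g' ≠ s(x, z) := by
  induction h with
  | base =>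
    have hE : C ∩ ({x, z} : Finset V).sym2 = {s(x, z)} := by
      ext g
      induction g with | _ a b
      have := hdiag s(a, b)
      simp only [Finset.mem_inter, Finset.mk_mem_sym2_iff, Finset.mem_insert,
        Finset.mem_singleton, Sym2.eq_iff, Sym2.mk_isDiag_iff] at this ⊢
      constructor
      · rintro ⟨h, rfl | rfl, rfl | rfl⟩ <;> simp_all
      · rintro (⟨rfl, rfl⟩ | ⟨rfl, rfl⟩)
        · simp [hC]
        · exact ⟨Sym2.eq_swap (a := a) ▸ hC, by simp, by simp⟩
    refine ⟨fun _ => x, ∅, by simp, ?_, by simp, ?_, ?_⟩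
    · rw [hE, Finset.card_pair hxz]; simp
    · intro u
      refine (Finset.card_filter_le _ _).trans ?_
      rw [hE]; simp
    · rintro p q r ⟨hpq, hqr, hpr, h₁, h₂, h₃⟩
      rw [hE] at h₁ h₂
      simp at h₁ h₂
      grind
  | step S u a b hS hu ha hb hab hua hub ih =>
    obtain ⟨c, F, hF, hcard, hcS, hfib, htri⟩ := ih
    set E := C ∩ S.sym2 with hEdef
    set E' := C ∩ (insert u S).sym2 with hE'def
    classical
    set N := E'.filter fun g => u ∈ g with hN
    have hEu : ∀ g ∈ E, u ∉ g := by
      intro g hg hug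
      simp only [hEdef, Finset.mem_inter, Finset.mem_sym2_iff] at hg
      exact hu (hg.2 u hug)
    have hsplit : ∀ g ∈ E', u ∉ g → g ∈ E := by
      intro g hg hug
      simp only [hEdef, hE'def, Finset.mem_inter, Finset.mem_sym2_iff] at hg ⊢
      refine ⟨hg.1, fun v hv => ?_⟩
      rcases Finset.mem_insert.1 (hg.2 v hv) with rfl | h
      · exact absurd hv hug
      · exact h
    have hEE' : E ⊆ E' := by
      intro g hg
      simp only [hEdef, hE'def, Finset.mem_inter, Finset.mem_sym2_iff] at hg ⊢
      exact ⟨hg.1, fun v hv => Finset.mem_insert_of_mem (hg.2 v hv)⟩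
    have hE'card : E.card + N.card ≤ E'.card := by
      rw [← Finset.card_union_of_disjoint]
      · exact Finset.card_le_card (Finset.union_subset hEE' (Finset.filter_subset _ _))
      · rw [Finset.disjoint_left]
        exact fun g hg hg' => hEu g hg (Finset.mem_filter.1 hg').2
    have huaN : s(u, a) ∈ N := by simp [hN, hE'def, hua, ha]
    have hubN : s(u, b) ∈ N := by simp [hN, hE'def, hub, hb]
    have hne : s(u, a) ≠ s(u, b) := by
      rw [Ne, Sym2.congr_right]
      exact hab
    set P : Finset (Sym2 V) := {s(u, a), s(u, b)} with hP
    have hPN : P ⊆ N := by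
      intro g hg
      simp only [hP, Finset.mem_insert, Finset.mem_singleton] at hg
      rcases hg with rfl | rfl <;> assumption
    have hPcard : P.card = 2 := Finset.card_pair hne
    have hxzu : u ∉ s(x, z) := by
      simp only [Sym2.mem_iff, not_or]
      exact ⟨fun h => hu (h ▸ hS.mem.1), fun h => hu (h ▸ hS.mem.2)⟩
    refine ⟨fun g => if u ∈ g then u else c g, F ∪ (N \ P), ?_, ?_, ?_, ?_, ?_⟩
    · simp only [Finset.mem_union, not_or, Finset.mem_sdiff]
      exact ⟨hF, fun h => hxzu (Finset.mem_filter.1 h.1).2⟩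
    · have h1 := Finset.card_union_le F (N \ P)
      have h2 := Finset.card_sdiff_add_card_eq_card hPN
      rw [Finset.card_insert_of_notMem hu]
      omega
    · intro g hg
      by_cases hug : u ∈ g
      · simp [hug]
      · simp only [hug, if_false]
        exact Finset.mem_insert_of_mem (hcS g (hsplit g hg hug))
    · intro w
      by_cases hw : w = u
      · subst hw
        refine (Finset.card_le_card (t := P) ?_).trans hPcard.le
        intro g hg
        simp only [Finset.mem_filter, Finset.mem_sdiff, Finset.mem_union, not_or] at hg
        by_cases hug : w ∈ g
        · by_contra hgP
          exact hg.1.2.2 ⟨Finset.mem_filter.2 ⟨hg.1.1, hug⟩, hgP⟩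
        · simp only [hug, if_false] at hg
          exact absurd (hg.2 ▸ hcS g (hsplit g hg.1.1 hug)) hu
      · refine (Finset.card_le_card ?_).trans (hfib w)
        intro g hg
        simp only [Finset.mem_filter, Finset.mem_sdiff, Finset.mem_union, not_or] at hg ⊢
        by_cases hug : u ∈ g
        · simp only [hug, if_true] at hg
          exact absurd hg.2.symm hw
        · simp only [hug, if_false] at hg
          exact ⟨⟨hsplit g hg.1.1 hug, hg.1.2.1⟩, hg.2⟩
    · intro p q r hpqr
      by_cases hupqr : u = p ∨ u = q ∨ u = r
      · obtain ⟨g, hg, g', hg', hgg, h₁, h₂⟩ :=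
          mem_triEdges_of_mem hpqr.1 hpqr.2.1 hpqr.2.2.1 hupqr
        exact ⟨g, hg, g', hg', hgg, by simp [h₁, h₂], fun h => hxzu (h ▸ h₁),
          fun h => hxzu (h ▸ h₂)⟩
      · have hug : ∀ g ∈ triEdges p q r, u ∉ g := by
          intro g hg
          simp only [triEdges, Finset.mem_insert, Finset.mem_singleton] at hg
          rcases hg with rfl | rfl | rfl <;> simp only [Sym2.mem_iff] <;> tauto
        have hmem : ∀ g ∈ triEdges p q r, g ∈ E \ F := by
          intro g hg
          have := hpqr.triEdges_subset hg
          simp only [Finset.mem_sdiff, Finset.mem_union, not_or] at this ⊢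
          exact ⟨hsplit g this.1 (hug g hg), this.2.1⟩
        obtain ⟨g, hg, g', hg', h₁, h₂, h₃⟩ := htri p q r
          ⟨hpqr.1, hpqr.2.1, hpqr.2.2.1, hmem _ (by simp [triEdges]),
            hmem _ (by simp [triEdges]), hmem _ (by simp [triEdges])⟩
        exact ⟨g, hg, g', hg', h₁, by simp [hug g hg, hug g' hg', h₂], h₃⟩

/-- Every vertex set of size at most `15` spans fewer than `9/5` edges per vertex. -/
def LocallySparse (X : Finset (Sym2 V)) : Prop :=
  ∀ S : Finset V, S.Nonempty → S.card ≤ 15 → 5 * (X ∩ S.sym2).card < 9 * S.card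

lemma Grown.card_le {X C : Finset (Sym2 V)} (hX : LocallySparse X) (hCX : C ⊆ X) {x z : V}
    (hxz : x ≠ z) (hC : s(x, z) ∈ C) (hdiag : ∀ e ∈ C, ¬ e.IsDiag) {S : Finset V}
    (h : Grown C x z S) : S.card ≤ 14 := by
  induction h with
  | base => exact Finset.card_le_two.trans (by norm_num)
  | step S u a b hS hu ha hb hab hua hub ih =>
    have hg : Grown C x z (insert u S) := .step S u a b hS hu ha hb hab hua hub
    obtain ⟨c, F, -, hcard, -⟩ := hg.exists_pairing hxz hC hdiag
    rw [Finset.card_insert_of_notMem hu] at hcard ⊢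
    have := hX (insert u S) ⟨u, by simp⟩ (by rw [Finset.card_insert_of_notMem hu]; omega)
    rw [Finset.card_insert_of_notMem hu] at this
    have := Finset.card_le_card
      (Finset.inter_subset_inter_right (u := (insert u S).sym2) hCX)
    omega

/-- In an untouched component Breaker can answer Maker's first edge so that a pairing
of the remaining edges blocks all triangles. -/
lemma LocallySparse.exists_first_answer [Fintype V] {X : Finset (Sym2 V)} (hX : LocallySparse X)
    (hdiag : ∀ e ∈ X, ¬ e.IsDiag) {e : Sym2 V} (he : e ∈ X) :
    ∃ f, f ≠ e ∧ Paired (triComponent X e) {e} {f} := by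
  classical
  induction e with | _ x z
  have hxz : x ≠ z := by simpa using hdiag _ he
  set C := triComponent X s(x, z) with hCdef
  have hCX : C ⊆ X := triComponent_subset _ _
  have heC : s(x, z) ∈ C := mem_triComponent.2 ⟨he, .refl⟩
  have hdiagC : ∀ e ∈ C, ¬ e.IsDiag := fun e h => hdiag e (hCX h)
  obtain ⟨S, hS, hmax⟩ := Finset.exists_max_image
    ((Finset.univ : Finset (Finset V)).filter fun S => Grown C x z S) Finset.card
    ⟨{x, z}, by simpa using Grown.base⟩
  simp only [Finset.mem_filter, Finset.mem_univ, true_and] at hS hmax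
  have hclosed : ∀ a b u, IsTriangleIn X a b u → s(a, b) ∈ C → a ∈ S → b ∈ S → u ∈ S := by
    intro a b u ht habC ha hb
    by_contra hu
    have hlink : ∀ g ∈ triEdges a b u, g ∈ C := fun g hg => mem_triComponent.2
      ⟨ht.triEdges_subset hg, (mem_triComponent.1 habC).2.tail
        ⟨a, b, u, ht, by simp [triEdges], hg⟩⟩
    have := hmax _ (Grown.step S u a b hS hu ha hb ht.1
      (Sym2.eq_swap (a := a) ▸ hlink s(a, u) (by simp [triEdges]))
      (Sym2.eq_swap (a := b) ▸ hlink s(b, u) (by simp [triEdges])))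
    rw [Finset.card_insert_of_notMem hu] at this
    omega
  have hCS : ∀ g, Relation.ReflTransGen (Linked X) s(x, z) g → g ∈ S.sym2 := by
    intro g hg
    induction hg with
    | refl => simp [hS.mem]
    | @tail g g' h₁ h₂ ih =>
      obtain ⟨a, b, u, ht, hg, hg'⟩ := h₂
      have hgC : g ∈ C := mem_triComponent.2 ⟨ht.triEdges_subset hg, h₁⟩
      obtain ⟨k₁, k₂, k₃, k₄, k₅, k₆⟩ := ht
      have hmem : a ∈ S ∧ b ∈ S ∧ u ∈ S := by
        simp only [triEdges, Finset.mem_insert, Finset.mem_singleton] at hg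
        rcases hg with rfl | rfl | rfl <;> rw [Finset.mk_mem_sym2_iff] at ih
        · exact ⟨ih.1, ih.2, hclosed a b u ⟨k₁, k₂, k₃, k₄, k₅, k₆⟩ hgC ih.1 ih.2⟩
        · exact ⟨hclosed b u a ⟨k₂, k₃.symm, k₁.symm, k₅, Sym2.eq_swap (a := a) ▸ k₆,
            Sym2.eq_swap (a := a) ▸ k₄⟩ hgC ih.1 ih.2, ih.1, ih.2⟩
        · exact ⟨ih.1, hclosed a u b ⟨k₃, k₂.symm, k₁, k₆, Sym2.eq_swap (a := b) ▸ k₅,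
            k₄⟩ hgC ih.1 ih.2, ih.2⟩
      simp only [triEdges, Finset.mem_insert, Finset.mem_singleton] at hg'
      rcases hg' with rfl | rfl | rfl <;> simp [hmem]
  have hCeq : C ∩ S.sym2 = C :=
    Finset.inter_eq_left.2 fun g hg => hCS g (mem_triComponent.1 hg).2
  obtain ⟨c, F, heF, hcard, -, hfib, htri⟩ := hS.exists_pairing hxz heC hdiagC
  have h14 := hS.card_le hX hCX hxz heC hdiagC
  have hdens := hX S ⟨x, hS.mem.1⟩ (by omega)
  have hle := Finset.card_le_card (Finset.inter_subset_inter_right (u := S.sym2) hCX)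
  have hchoose : (C ∩ S.sym2).card ≤ S.card.choose 2 := by
    rw [← Sym2.card_image_offDiag]
    refine Finset.card_le_card fun g hg => ?_
    rw [Finset.mem_inter] at hg
    induction g with | _ a b
    have hab : a ≠ b := by simpa using hdiagC _ hg.1
    rw [Finset.mk_mem_sym2_iff] at hg
    exact Finset.mem_image.2 ⟨(a, b), by simp [hg.2, hab], rfl⟩
  have hF1 : F.card ≤ 1 := by
    by_cases hs : S.card ≤ 4
    · rw [Nat.choose_two_right] at hchoose
      interval_cases S.card <;> omega
    · omega
  rw [hCeq] at hfib htri
  have : ∃ f, f ≠ s(x, z) ∧ F ⊆ {f} := by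
    obtain hF0 | hF0 := Nat.le_one_iff_eq_zero_or_eq_one.1 hF1
    · exact ⟨s(x, x), by simp [hxz], by simp [Finset.card_eq_zero.1 hF0]⟩
    · obtain ⟨f, rfl⟩ := Finset.card_eq_one.1 hF0
      exact ⟨f, fun h => heF (by simp [h]), subset_rfl⟩
  obtain ⟨f, hfe, hFf⟩ := this
  have hpair : Paired C {s(x, z)} F := ⟨c, hfib, fun p q r h => by
    simpa only [Finset.mem_singleton] using htri p q r h⟩
  exact ⟨f, hfe, hpair.mono (fun _ _ h => h) (Finset.sdiff_subset_sdiff le_rfl hFf)⟩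

/-- Breaker may always claim a prescribed edge if it is free. -/
lemma exists_legal_answer {α : Type*} [DecidableEq α] (R : Finset α) (f : α) :
    ∃ B' ⊆ R, B'.card = min 1 R.card ∧ (f ∈ R → f ∈ B') := by
  by_cases hf : f ∈ R
  · exact ⟨{f}, by simpa using hf,
      by rw [Finset.card_singleton, min_eq_left (Finset.card_pos.2 ⟨f, hf⟩)], by simp⟩
  · obtain ⟨B', h₁, h₂⟩ := Finset.exists_subset_card_eq (s := R) (min_le_right 1 R.card)
    exact ⟨B', h₁, h₂, fun h => absurd h hf⟩

lemma LocallySparse.oBreakerBlock_aux [Fintype V] {X : Finset (Sym2 V)} (hX : LocallySparse X)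
    (hdiag : ∀ e ∈ X, ¬ e.IsDiag) (k : ℕ) : ∀ (M : Finset (V × V)) (B : Finset (Sym2 V)),
    (X \ (undirect M ∪ B)).card = k → undirect M ⊆ X → Disjoint (undirect M) B →
    (∀ e ∈ undirect M, Paired (triComponent X e) (undirect M) B) →
    OBreakerBlock X HasAcyclicTriangle 1 M B := by
  induction k using Nat.strong_induction_on with
  | _ k ih =>
  intro M B hk hMX hdisj hinv
  have hF : ¬ HasAcyclicTriangle M := by
    rintro ⟨x, y, z, hxy, hyz, hxz, h₁, h₂, h₃⟩
    have hU : triEdges x y z ⊆ undirect M := by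
      intro g hg
      simp only [triEdges, Finset.mem_insert, Finset.mem_singleton] at hg
      rcases hg with rfl | rfl | rfl <;> simp [mem_undirect, h₁, h₂, h₃]
    have ht : IsTriangleIn X x y z := ⟨hxy, hyz, hxz, hMX (hU (by simp [triEdges])),
      hMX (hU (by simp [triEdges])), hMX (hU (by simp [triEdges]))⟩
    obtain ⟨c, -, hc⟩ := hinv s(x, y) (hU (by simp [triEdges]))
    have hmem : ∀ g ∈ triEdges x y z, g ∈ triComponent X s(x, y) \ B := fun g hg =>
      Finset.mem_sdiff.2 ⟨mem_triComponent.2 ⟨hMX (hU hg),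
        .single ⟨x, y, z, ht, by simp [triEdges], hg⟩⟩,
        Finset.disjoint_left.1 hdisj (hU hg)⟩
    obtain ⟨g, hg, -, -, -, -, hgU, -⟩ := hc x y z ⟨hxy, hyz, hxz,
      hmem _ (by simp [triEdges]), hmem _ (by simp [triEdges]), hmem _ (by simp [triEdges])⟩
    exact hgU (hU hg)
  have hresp : ∀ x y : V, ∃ R : Finset (Sym2 V), s(x, y) ∈ X → s(x, y) ∉ undirect M ∪ B →
      R ⊆ X \ (insert s(x, y) (undirect M) ∪ B) ∧
      R.card = min 1 (X \ (insert s(x, y) (undirect M) ∪ B)).card ∧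
      OBreakerBlock X HasAcyclicTriangle 1 (insert (x, y) M) (B ∪ R) := by
    intro x y
    by_cases hlegal : s(x, y) ∈ X ∧ s(x, y) ∉ undirect M ∪ B
    swap
    · exact ⟨∅, fun h₁ h₂ => absurd ⟨h₁, h₂⟩ hlegal⟩
    obtain ⟨heX, hefree⟩ := hlegal
    set e := s(x, y) with he
    set U := undirect M with hU
    have hefree' := hefree
    simp only [Finset.mem_union, not_or] at hefree'
    have heC : e ∈ triComponent X e := mem_triComponent.2 ⟨heX, .refl⟩
    have hanswer : ∃ f, ∀ B', (f ∈ triComponent X e → f ∉ insert e U ∪ B → f ∈ B') →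
        Paired (triComponent X e) (insert e U) (B ∪ B') := by
      by_cases htouched : ∃ g ∈ U, g ∈ triComponent X e
      · obtain ⟨g, hgU, hgC⟩ := htouched
        have := hinv g hgU
        rw [triComponent_eq hgC] at this
        exact this.exists_answer heC hefree'.2
      · push Not at htouched
        obtain ⟨f, hfe, hp⟩ := hX.exists_first_answer hdiag heX
        refine ⟨f, fun B' hB' => hp.mono ?_ ?_⟩
        · intro g hgC hg
          rcases Finset.mem_insert.1 hg with rfl | hg
          · simp
          · exact absurd hgC (htouched g hg)
        · intro g hg
          simp only [Finset.mem_sdiff, Finset.mem_union, not_or, Finset.mem_singleton] at hg ⊢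
          refine ⟨hg.1, ?_⟩
          rintro rfl
          refine hg.2.2 (hB' hg.1 ?_)
          simp only [Finset.mem_union, Finset.mem_insert, not_or]
          exact ⟨⟨hfe, fun h => htouched _ h hg.1⟩, hg.2.1⟩
    obtain ⟨f, hf⟩ := hanswer
    obtain ⟨R, hRsub, hRcard, hfR⟩ := exists_legal_answer (X \ (insert e U ∪ B)) f
    refine ⟨R, fun _ _ => ⟨hRsub, hRcard, ?_⟩⟩
    have hpe := hf R fun h₁ h₂ => hfR (Finset.mem_sdiff.2 ⟨triComponent_subset _ _ h₁, h₂⟩)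
    have hUins : undirect (insert (x, y) M) = insert e U := undirect_insert x y M
    refine ih _ ?_ _ _ rfl ?_ ?_ ?_
    · rw [← hk, hUins]
      refine Finset.card_lt_card (Finset.ssubset_iff_of_subset ?_ |>.2 ⟨e, ?_, ?_⟩)
      · refine Finset.sdiff_subset_sdiff le_rfl ?_
        exact Finset.union_subset_union (Finset.subset_insert _ _) Finset.subset_union_left
      · exact Finset.mem_sdiff.2 ⟨heX, hefree⟩
      · simp
    · rw [hUins]
      exact Finset.insert_subset heX hMX
    · rw [hUins, Finset.disjoint_union_right, Finset.disjoint_insert_left]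
      refine ⟨⟨hefree'.2, hdisj⟩, ?_⟩
      rw [Finset.disjoint_right]
      exact fun g hg h => (Finset.mem_sdiff.1 (hRsub hg)).2 (Finset.mem_union_left _ h)
    · rw [hUins]
      intro g hg
      by_cases hgC : g ∈ triComponent X e
      · rw [triComponent_eq hgC]
        exact hpe
      · have hgU : g ∈ U := (Finset.mem_insert.1 hg).resolve_left fun h => hgC (h ▸ heC)
        refine (hinv g hgU).mono ?_ (Finset.sdiff_subset_sdiff le_rfl Finset.subset_union_left)
        intro k hk hkU
        refine (Finset.mem_insert.1 hkU).resolve_left ?_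
        rintro rfl
        exact hgC (triComponent_eq hk ▸ mem_triComponent.2 ⟨hMX hgU, .refl⟩)
  choose resp hresp using hresp
  exact .step M B hF resp (fun x y h₁ h₂ => (hresp x y h₁ h₂).1)
    (fun x y h₁ h₂ => (hresp x y h₁ h₂).2.1) fun x y h₁ h₂ => (hresp x y h₁ h₂).2.2

/-- Breaker wins the acyclic triangle game on locally sparse boards. -/
theorem LocallySparse.oBreakerBlock [Fintype V] {X : Finset (Sym2 V)} (hX : LocallySparse X)
    (hdiag : ∀ e ∈ X, ¬ e.IsDiag) : OBreakerBlock X HasAcyclicTriangle 1 ∅ ∅ :=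
  hX.oBreakerBlock_aux hdiag _ ∅ ∅ rfl (by simp [undirect]) (by simp) (by simp [undirect])

/-! ### Random subsets -/

section EdgeProb

variable {α : Type*} [DecidableEq α] {E : Finset α} {p : ℝ}

lemma edgeProb_eq_sum_ite (E : Finset α) (p : ℝ) (P : Finset α → Prop) [DecidablePred P] :
    edgeProb E p P =
      ∑ A ∈ E.powerset, if P A then p ^ A.card * (1 - p) ^ (E.card - A.card) else 0 := by
  refine Finset.sum_congr rfl fun A _ => ?_
  by_cases h : P A <;> simp [h]

lemma edgeProb_superset {D : Finset α} (hD : D ⊆ E) (p : ℝ) :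
    edgeProb E p (fun A => D ⊆ A) = p ^ D.card := by
  classical
  have hsum : edgeProb E p (fun A => D ⊆ A) =
      ∑ A ∈ (E \ D).powerset, p ^ D.card *
        (p ^ A.card * (1 - p) ^ ((E \ D).card - A.card)) := by
    rw [edgeProb_eq_sum_ite, ← Finset.sum_filter]
    refine Finset.sum_bij' (fun A _ => A \ D) (fun A _ => A ∪ D) ?_ ?_ ?_ ?_ ?_
    · intro A hA
      simp only [Finset.mem_filter, Finset.mem_powerset] at hA ⊢
      exact Finset.sdiff_subset_sdiff hA.1 le_rfl
    · intro A hA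
      simp only [Finset.mem_filter, Finset.mem_powerset] at hA ⊢
      exact ⟨Finset.union_subset (hA.trans Finset.sdiff_subset) hD, Finset.subset_union_right⟩
    · intro A hA
      exact Finset.sdiff_union_of_subset (Finset.mem_filter.1 hA).2
    · intro A hA
      rw [Finset.union_sdiff_right]
      exact Finset.sdiff_eq_self_of_disjoint
        (Finset.disjoint_of_subset_left (Finset.mem_powerset.1 hA) Finset.sdiff_disjoint)
    · intro A hA
      simp only [Finset.mem_filter, Finset.mem_powerset] at hA
      have h₁ := Finset.card_sdiff_add_card_eq_card hA.2
      have h₂ := Finset.card_sdiff_add_card_eq_card hD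
      have h₃ := Finset.card_le_card hA.1
      rw [← mul_assoc, ← pow_add]
      congr 2 <;> omega
  rw [hsum, ← Finset.mul_sum, Finset.sum_pow_mul_eq_add_pow]
  simp

omit [DecidableEq α] in
lemma edgeProb_weight_nonneg (hp0 : 0 ≤ p) (hp1 : p ≤ 1) (A : Finset α) :
    0 ≤ p ^ A.card * (1 - p) ^ (E.card - A.card) :=
  mul_nonneg (pow_nonneg hp0 _) (pow_nonneg (by linarith) _)

omit [DecidableEq α] in
lemma sum_edgeProb_weight (E : Finset α) (p : ℝ) :
    ∑ A ∈ E.powerset, p ^ A.card * (1 - p) ^ (E.card - A.card) = 1 := by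
  rw [Finset.sum_pow_mul_eq_add_pow]
  simp

lemma edgeProb_le_one (hp0 : 0 ≤ p) (hp1 : p ≤ 1) (P : Finset α → Prop) :
    edgeProb E p P ≤ 1 := by
  rw [← sum_edgeProb_weight E p, edgeProb]
  refine Finset.sum_le_sum fun A _ => ?_
  split_ifs
  · exact le_rfl
  · exact edgeProb_weight_nonneg hp0 hp1 A

lemma edgeProb_mono (hp0 : 0 ≤ p) (hp1 : p ≤ 1) {P Q : Finset α → Prop}
    (h : ∀ A ⊆ E, P A → Q A) : edgeProb E p P ≤ edgeProb E p Q := by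
  refine Finset.sum_le_sum fun A hA => ?_
  by_cases hP : P A
  · simp [hP, h A (Finset.mem_powerset.1 hA) hP]
  · rw [if_neg hP]
    split_ifs
    exacts [edgeProb_weight_nonneg hp0 hp1 A, le_rfl]

/-- Union bound. -/
lemma one_sub_sum_le_edgeProb (hp0 : 0 ≤ p) (hp1 : p ≤ 1) {P : Finset α → Prop} {ι : Type*}
    (s : Finset ι) (H : ι → Finset α) (hH : ∀ i ∈ s, H i ⊆ E)
    (hP : ∀ A ⊆ E, ¬ P A → ∃ i ∈ s, H i ⊆ A) :
    1 - ∑ i ∈ s, p ^ (H i).card ≤ edgeProb E p P := by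
  classical
  rw [sub_le_iff_le_add, Finset.sum_congr rfl fun i hi => (edgeProb_superset (hH i hi) p).symm]
  simp only [edgeProb_eq_sum_ite]
  rw [Finset.sum_comm, ← Finset.sum_add_distrib]
  refine (sum_edgeProb_weight E p).symm.trans_le ?_
  refine Finset.sum_le_sum fun A hA => ?_
  have hw := edgeProb_weight_nonneg (E := E) hp0 hp1 A
  have hnn : ∀ i ∈ s, 0 ≤ (if H i ⊆ A then p ^ A.card * (1 - p) ^ (E.card - A.card) else 0) := by
    intro i _
    split_ifs
    exacts [hw, le_rfl]
  by_cases hPA : P A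
  · rw [if_pos hPA]
    linarith [Finset.sum_nonneg hnn]
  · obtain ⟨i, hi, hiA⟩ := hP A (Finset.mem_powerset.1 hA) hPA
    have := Finset.single_le_sum hnn hi
    rw [if_pos hiA] at this
    rw [if_neg hPA]
    linarith

/-- Second moment bound. -/
lemma two_sub_le_edgeProb (hp0 : 0 ≤ p) (hp1 : p ≤ 1) {P : Finset α → Prop} {ι : Type*}
    (s : Finset ι) (H : ι → Finset α) (hH : ∀ i ∈ s, H i ⊆ E)
    (hP : ∀ A ⊆ E, ∀ i ∈ s, H i ⊆ A → P A) {μ : ℝ} (hμ : μ = ∑ i ∈ s, p ^ (H i).card)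
    (hμ0 : 0 < μ) :
    2 - (∑ i ∈ s, ∑ j ∈ s, p ^ (H i ∪ H j).card) / μ ^ 2 ≤ edgeProb E p P := by
  classical
  set w : Finset α → ℝ := fun A => p ^ A.card * (1 - p) ^ (E.card - A.card) with hw
  set N : Finset α → ℝ := fun A => ∑ i ∈ s, if H i ⊆ A then 1 else 0 with hN
  have hw0 : ∀ A, 0 ≤ w A := edgeProb_weight_nonneg hp0 hp1
  have h1 : ∑ A ∈ E.powerset, N A * w A = μ := by
    rw [hμ, Finset.sum_congr rfl fun i hi => (edgeProb_superset (hH i hi) p).symm]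
    simp only [edgeProb_eq_sum_ite, hN, Finset.sum_mul, ite_mul, one_mul, zero_mul]
    exact Finset.sum_comm
  have h2 : ∑ A ∈ E.powerset, N A ^ 2 * w A = ∑ i ∈ s, ∑ j ∈ s, p ^ (H i ∪ H j).card := by
    have : ∀ i ∈ s, ∀ j ∈ s, p ^ (H i ∪ H j).card =
        ∑ A ∈ E.powerset, if H i ⊆ A ∧ H j ⊆ A then w A else 0 := by
      intro i hi j hj
      rw [← edgeProb_superset (Finset.union_subset (hH i hi) (hH j hj)) p, edgeProb_eq_sum_ite]
      simp only [Finset.union_subset_iff, hw]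
    rw [Finset.sum_congr rfl fun i hi => Finset.sum_congr rfl fun j hj => this i hi j hj]
    have hcomm : ∀ i ∈ s, ∑ j ∈ s, ∑ A ∈ E.powerset, (if H i ⊆ A ∧ H j ⊆ A then w A else 0) =
        ∑ A ∈ E.powerset, ∑ j ∈ s, if H i ⊆ A ∧ H j ⊆ A then w A else 0 :=
      fun i _ => Finset.sum_comm
    rw [Finset.sum_congr rfl hcomm, Finset.sum_comm]
    refine Finset.sum_congr rfl fun A _ => ?_
    rw [sq, hN, Finset.sum_mul_sum, Finset.sum_mul]
    refine Finset.sum_congr rfl fun i _ => ?_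
    rw [Finset.sum_mul]
    refine Finset.sum_congr rfl fun j _ => ?_
    by_cases hi : H i ⊆ A <;> by_cases hj : H j ⊆ A <;> simp [hi, hj]
  have h3 : ∑ A ∈ E.powerset, (2 * N A / μ - N A ^ 2 / μ ^ 2) * w A =
      2 - (∑ i ∈ s, ∑ j ∈ s, p ^ (H i ∪ H j).card) / μ ^ 2 := by
    rw [← h2]
    have : ∀ A, (2 * N A / μ - N A ^ 2 / μ ^ 2) * w A =
        (2 / μ) * (N A * w A) - (N A ^ 2 * w A) / μ ^ 2 := fun A => by ring
    simp only [this]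
    rw [Finset.sum_sub_distrib, ← Finset.mul_sum, ← Finset.sum_div, h1]
    field_simp
  rw [← h3, edgeProb]
  refine Finset.sum_le_sum fun A hA => ?_
  split_ifs with hPA
  · have : 2 * N A / μ - N A ^ 2 / μ ^ 2 ≤ 1 := by
      have := sq_nonneg (N A / μ - 1)
      have e : 2 * N A / μ - N A ^ 2 / μ ^ 2 = 1 - (N A / μ - 1) ^ 2 := by ring
      linarith
    exact (mul_le_mul_of_nonneg_right this (hw0 A)).trans_eq (one_mul _)
  · have : N A = 0 := Finset.sum_eq_zero fun i hi =>
      if_neg fun h => hPA (hP A (Finset.mem_powerset.1 hA) i hi h)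
    simp [this]

end EdgeProb

/-! ### The sparse regime -/

lemma pow_le_rpow_pow {n : ℝ} (hn : 1 ≤ n) {k m : ℕ} (h : 9 * k ≤ 5 * m) :
    n ^ k ≤ (n ^ (5 / 9 : ℝ)) ^ m := by
  rw [← Real.rpow_natCast n k, ← Real.rpow_mul_natCast (by linarith)]
  refine Real.rpow_le_rpow_of_exponent_le hn ?_
  have : (9 : ℝ) * k ≤ 5 * m := by exact_mod_cast h
  linarith

lemma rpow_pow_le_pow {n : ℝ} (hn : 1 ≤ n) {k m : ℕ} (h : 5 * m ≤ 9 * k) :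
    (n ^ (5 / 9 : ℝ)) ^ m ≤ n ^ k := by
  rw [← Real.rpow_natCast n k, ← Real.rpow_mul_natCast (by linarith)]
  refine Real.rpow_le_rpow_of_exponent_le hn ?_
  have : (5 : ℝ) * m ≤ 9 * k := by exact_mod_cast h
  linarith

lemma edgeProb_locallySparse_ge {n : ℕ} (hn : 1 ≤ n) {p : ℝ} (hp0 : 0 ≤ p) (hp1 : p ≤ 1)
    (hq : p * (n : ℝ) ^ (5 / 9 : ℝ) ≤ 1) :
    1 - 15 * 2 ^ 120 * (p * (n : ℝ) ^ (5 / 9 : ℝ)) ≤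
      edgeProb (completeEdges n) p LocallySparse := by
  set q := p * (n : ℝ) ^ (5 / 9 : ℝ) with hqdef
  have hn1 : (1 : ℝ) ≤ n := by exact_mod_cast hn
  have hq0 : 0 ≤ q := by positivity
  set m : ℕ → ℕ := fun k => (9 * k + 4) / 5 with hm
  let T : Finset (Σ _ : ℕ, Σ _ : Finset (Fin n), Finset (Sym2 (Fin n))) :=
    (Finset.Icc 1 15).sigma fun k =>
      (Finset.powersetCard k Finset.univ).sigma fun S =>
        Finset.powersetCard (m k) (completeEdges n ∩ S.sym2)
  have hsum : ∑ i ∈ T, p ^ i.2.2.card ≤ 15 * 2 ^ 120 * q := by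
    have hk : ∀ k ∈ Finset.Icc 1 15,
        ∑ j ∈ (Finset.powersetCard k (Finset.univ : Finset (Fin n))).sigma fun S =>
          Finset.powersetCard (m k) (completeEdges n ∩ S.sym2), p ^ j.2.card
          ≤ 2 ^ 120 * q := by
      intro k hk
      rw [Finset.mem_Icc] at hk
      rw [Finset.sum_sigma]
      have hS : ∀ S ∈ Finset.powersetCard k (Finset.univ : Finset (Fin n)),
          ∑ D ∈ Finset.powersetCard (m k) (completeEdges n ∩ S.sym2), p ^ D.card
            ≤ 2 ^ 120 * p ^ m k := by
        intro S hS
        have hSk := (Finset.mem_powersetCard.1 hS).2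
        rw [Finset.sum_congr rfl fun D hD => by rw [(Finset.mem_powersetCard.1 hD).2],
          Finset.sum_const, nsmul_eq_mul, Finset.card_powersetCard]
        refine mul_le_mul_of_nonneg_right ?_ (by positivity)
        have hcard : (completeEdges n ∩ S.sym2).card ≤ 120 := by
          refine (Finset.card_le_card Finset.inter_subset_right).trans ?_
          rw [Finset.card_sym2, hSk]
          exact (Nat.choose_le_choose 2 (show k + 1 ≤ 16 by omega)).trans (by decide)
        exact_mod_cast (Nat.choose_le_two_pow _ _).trans
          (Nat.pow_le_pow_right (by norm_num) hcard)
      refine (Finset.sum_le_sum hS).trans ?_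
      rw [Finset.sum_const, nsmul_eq_mul, Finset.card_powersetCard, Finset.card_fin]
      have h1 : ((n.choose k : ℕ) : ℝ) ≤ (n : ℝ) ^ k := by
        exact_mod_cast Nat.choose_le_pow n k
      have h2 : (n : ℝ) ^ k * p ^ m k ≤ q := by
        calc (n : ℝ) ^ k * p ^ m k ≤ ((n : ℝ) ^ (5 / 9 : ℝ)) ^ m k * p ^ m k :=
              mul_le_mul_of_nonneg_right (pow_le_rpow_pow hn1 (by simp only [hm]; omega))
                (by positivity)
          _ = q ^ m k := by rw [hqdef, mul_pow, mul_comm]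
          _ ≤ q := pow_le_of_le_one hq0 hq (by simp only [hm]; omega)
      calc (n.choose k : ℝ) * (2 ^ 120 * p ^ m k)
          = 2 ^ 120 * ((n.choose k : ℝ) * p ^ m k) := by ring
        _ ≤ 2 ^ 120 * ((n : ℝ) ^ k * p ^ m k) := by gcongr
        _ ≤ 2 ^ 120 * q := by gcongr
    calc ∑ i ∈ T, p ^ i.2.2.card ≤ ∑ k ∈ Finset.Icc 1 15, 2 ^ 120 * q := by
          rw [Finset.sum_sigma]
          exact Finset.sum_le_sum hk
      _ = 15 * 2 ^ 120 * q := by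
          rw [Finset.sum_const, Nat.card_Icc, nsmul_eq_mul]; norm_num; ring
  refine le_trans (by linarith) (one_sub_sum_le_edgeProb hp0 hp1 T (fun i => i.2.2) ?_ ?_)
  · rintro ⟨k, S, D⟩ hi
    simp only [T, Finset.mem_sigma, Finset.mem_powersetCard] at hi
    exact hi.2.2.1.trans Finset.inter_subset_left
  · intro A hA hsparse
    simp only [LocallySparse, not_forall, not_lt] at hsparse
    obtain ⟨S, hne, h15, hdense⟩ := hsparse
    obtain ⟨D, hD, hDcard⟩ := Finset.exists_subset_card_eq
      (show m S.card ≤ (A ∩ S.sym2).card by simp only [hm]; omega)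
    refine ⟨⟨S.card, S, D⟩, ?_, hD.trans Finset.inter_subset_left⟩
    simp only [T, Finset.mem_sigma, Finset.mem_powersetCard, Finset.mem_Icc]
    exact ⟨⟨hne.card_pos, h15⟩, ⟨Finset.subset_univ _, trivial⟩,
      hD.trans (Finset.inter_subset_inter_right hA), hDcard⟩

/-! ### The dense regime -/

/-- The edges of `K₅` minus an edge. -/
def nearK5 : Finset (Sym2 (Fin 5)) :=
  {s(0, 1), s(0, 2), s(1, 2), s(0, 3), s(1, 3), s(2, 3), s(0, 4), s(1, 4), s(2, 4)}

lemma nearK5_density : ∀ S : Finset (Fin 5), 5 * (nearK5 ∩ S.sym2).card ≤ 9 * S.card := by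
  decide

/-- The `a`-th vertex of the `i`-th of five disjoint classes of size `m` in `Fin n`. -/
def classVertex {n m : ℕ} (h : 5 * m ≤ n) (i : Fin 5) (a : Fin m) : Fin n :=
  ⟨5 * a.val + i.val, by omega⟩

lemma classVertex_inj {n m : ℕ} {h : 5 * m ≤ n} {i j : Fin 5} {a b : Fin m} :
    classVertex h i a = classVertex h j b ↔ i = j ∧ a = b := by
  simp only [classVertex, Fin.ext_iff]
  omega

/-- The copy of `K₅` minus an edge with one vertex, chosen by `f`, in each class. -/
def partiteCopy {n m : ℕ} (h : 5 * m ≤ n) (f : Fin 5 → Fin m) : Finset (Sym2 (Fin n)) :=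
  nearK5.image (Sym2.map fun i => classVertex h i (f i))

lemma classVertex_injective {n m : ℕ} (h : 5 * m ≤ n) (f : Fin 5 → Fin m) :
    Function.Injective fun i => classVertex h i (f i) :=
  fun _ _ hij => (classVertex_inj.1 hij).1

lemma card_partiteCopy {n m : ℕ} (h : 5 * m ≤ n) (f : Fin 5 → Fin m) :
    (partiteCopy h f).card = 9 := by
  rw [partiteCopy, Finset.card_image_of_injective _
    (Sym2.map.injective (classVertex_injective h f))]
  rfl

lemma card_partiteCopy_inter_le {n m : ℕ} (h : 5 * m ≤ n) (f g : Fin 5 → Fin m) :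
    (partiteCopy h f ∩ partiteCopy h g).card ≤
      (nearK5 ∩ (Finset.univ.filter fun i => f i = g i).sym2).card := by
  refine (Finset.card_le_card ?_).trans
    (Finset.card_image_le (f := Sym2.map fun i => classVertex h i (f i)))
  intro e he
  simp only [partiteCopy, Finset.mem_inter, Finset.mem_image] at he
  obtain ⟨⟨d, hd, rfl⟩, d', hd', hdd⟩ := he
  refine Finset.mem_image.2 ⟨d, Finset.mem_inter.2 ⟨hd, ?_⟩, rfl⟩
  induction d with | _ i j
  induction d' with | _ k l
  simp only [Sym2.map_mk, Sym2.eq_iff, classVertex_inj] at hdd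
  simp only [Finset.mk_mem_sym2_iff, Finset.mem_filter, Finset.mem_univ, true_and]
  rcases hdd with ⟨⟨rfl, h₁⟩, rfl, h₂⟩ | ⟨⟨rfl, h₁⟩, rfl, h₂⟩
  · exact ⟨h₁.symm, h₂.symm⟩
  · exact ⟨h₂.symm, h₁.symm⟩

lemma card_agreeing {m : ℕ} (S : Finset (Fin 5)) (f : Fin 5 → Fin m) :
    ((Finset.univ : Finset (Fin 5 → Fin m)).filter fun g => ∀ i ∈ S, f i = g i).card =
      m ^ (5 - S.card) := by
  have : ((Finset.univ : Finset (Fin 5 → Fin m)).filter fun g => ∀ i ∈ S, f i = g i) =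
      Fintype.piFinset fun i => if i ∈ S then {f i} else Finset.univ := by
    ext g
    simp only [Finset.mem_filter, Finset.mem_univ, true_and, Fintype.mem_piFinset]
    refine forall_congr' fun i => ?_
    by_cases hi : i ∈ S <;> simp [hi, eq_comm]
  rw [this, Fintype.card_piFinset]
  have h2 : ∀ i, (if i ∈ S then {f i} else (Finset.univ : Finset (Fin m))).card =
      if i ∈ S then 1 else m := fun i => by split_ifs <;> simp
  simp only [h2]
  rw [Finset.prod_ite, Finset.prod_const_one, one_mul, Finset.prod_const]
  congr 1
  rw [Finset.filter_not, Finset.card_sdiff_of_subset (Finset.filter_subset _ _)]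
  simp

lemma sum_pow_card_union_le {n m : ℕ} (h : 5 * m ≤ n) (hm : 1 ≤ m) {p : ℝ} (hp0 : 0 ≤ p)
    (hp1 : p ≤ 1) (hq : 1 ≤ p * (m : ℝ) ^ (5 / 9 : ℝ)) :
    ∑ f : Fin 5 → Fin m, ∑ g : Fin 5 → Fin m,
        p ^ (partiteCopy h f ∪ partiteCopy h g).card ≤
      (1 + 32 / (p * (m : ℝ) ^ (5 / 9 : ℝ))) * ((m : ℝ) ^ 5 * p ^ 9) ^ 2 := by
  set q := p * (m : ℝ) ^ (5 / 9 : ℝ) with hqdef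
  have hm1 : (1 : ℝ) ≤ m := by exact_mod_cast hm
  have hq0 : 0 < q := by linarith
  set e : Finset (Fin 5) → ℕ := fun S => (nearK5 ∩ S.sym2).card with he
  have he9 : ∀ S, e S ≤ 9 := fun S => Finset.card_le_card Finset.inter_subset_left
  have hpt : ∀ f g : Fin 5 → Fin m, p ^ (partiteCopy h f ∪ partiteCopy h g).card ≤
      p ^ 18 + ∑ S ∈ (Finset.univ : Finset (Finset (Fin 5))).filter (fun S => 1 ≤ e S),
        if ∀ i ∈ S, f i = g i then p ^ (18 - e S) else 0 := by
    intro f g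
    set S₀ := Finset.univ.filter fun i => f i = g i with hS₀
    have hle : p ^ (partiteCopy h f ∪ partiteCopy h g).card ≤ p ^ (18 - e S₀) := by
      refine pow_le_pow_of_le_one hp0 hp1 ?_
      have h1 := card_partiteCopy_inter_le h f g
      rw [← hS₀] at h1
      have h2 := Finset.card_union_add_card_inter (partiteCopy h f) (partiteCopy h g)
      rw [card_partiteCopy, card_partiteCopy] at h2
      simp only [he]
      omega
    have hnn : ∀ S ∈ (Finset.univ : Finset (Finset (Fin 5))).filter (fun S => 1 ≤ e S),
        0 ≤ (if ∀ i ∈ S, f i = g i then p ^ (18 - e S) else 0) := by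
      intro S _
      split_ifs <;> positivity
    by_cases h0 : 1 ≤ e S₀
    · have := Finset.single_le_sum hnn (Finset.mem_filter.2 ⟨Finset.mem_univ S₀, h0⟩)
      rw [if_pos (by simp [hS₀])] at this
      linarith [pow_nonneg hp0 18]
    · have : e S₀ = 0 := by omega
      rw [this, Nat.sub_zero] at hle
      linarith [Finset.sum_nonneg hnn]
  have hS : ∀ S ∈ (Finset.univ : Finset (Finset (Fin 5))).filter (fun S => 1 ≤ e S),
      ∑ f : Fin 5 → Fin m, ∑ g : Fin 5 → Fin m,
        (if ∀ i ∈ S, f i = g i then p ^ (18 - e S) else 0) ≤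
        ((m : ℝ) ^ 5 * p ^ 9) ^ 2 / q := by
    intro S hS
    have hS1 : 1 ≤ e S := (Finset.mem_filter.1 hS).2
    have hScard : S.card ≤ 5 := S.card_le_univ
    have hinner : ∀ f : Fin 5 → Fin m, ∑ g : Fin 5 → Fin m,
        (if ∀ i ∈ S, f i = g i then p ^ (18 - e S) else 0) =
          (m : ℝ) ^ (5 - S.card) * p ^ (18 - e S) := by
      intro f
      rw [← Finset.sum_filter, Finset.sum_const, card_agreeing, nsmul_eq_mul, Nat.cast_pow]
    rw [Finset.sum_congr rfl fun f _ => hinner f, Finset.sum_const, nsmul_eq_mul,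
      Finset.card_univ, Fintype.card_fun, Fintype.card_fin, Fintype.card_fin, le_div_iff₀ hq0,
      Nat.cast_pow]
    have hqle : q ≤ p ^ e S * (m : ℝ) ^ S.card := by
      calc q ≤ q ^ e S := le_self_pow₀ hq (by omega)
        _ = p ^ e S * ((m : ℝ) ^ (5 / 9 : ℝ)) ^ e S := by rw [hqdef, mul_pow]
        _ ≤ p ^ e S * (m : ℝ) ^ S.card := by
            gcongr
            exact rpow_pow_le_pow hm1 (nearK5_density S)
    calc (m : ℝ) ^ 5 * ((m : ℝ) ^ (5 - S.card) * p ^ (18 - e S)) * q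
        ≤ (m : ℝ) ^ 5 * ((m : ℝ) ^ (5 - S.card) * p ^ (18 - e S)) *
          (p ^ e S * (m : ℝ) ^ S.card) := by gcongr
      _ = (m : ℝ) ^ 5 * (m : ℝ) ^ (5 - S.card + S.card) * p ^ (18 - e S + e S) := by
          rw [pow_add, pow_add]; ring
      _ = ((m : ℝ) ^ 5 * p ^ 9) ^ 2 := by
          rw [Nat.sub_add_cancel hScard, Nat.sub_add_cancel ((he9 S).trans (by norm_num))]
          ring
  calc ∑ f : Fin 5 → Fin m, ∑ g : Fin 5 → Fin m,
        p ^ (partiteCopy h f ∪ partiteCopy h g).card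
      ≤ ∑ f : Fin 5 → Fin m, ∑ g : Fin 5 → Fin m, (p ^ 18 +
          ∑ S ∈ (Finset.univ : Finset (Finset (Fin 5))).filter (fun S => 1 ≤ e S),
            if ∀ i ∈ S, f i = g i then p ^ (18 - e S) else 0) :=
        Finset.sum_le_sum fun f _ => Finset.sum_le_sum fun g _ => hpt f g
    _ = ((m : ℝ) ^ 5 * p ^ 9) ^ 2 +
          ∑ S ∈ (Finset.univ : Finset (Finset (Fin 5))).filter (fun S => 1 ≤ e S),
            ∑ f : Fin 5 → Fin m, ∑ g : Fin 5 → Fin m,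
              if ∀ i ∈ S, f i = g i then p ^ (18 - e S) else 0 := by
        simp only [Finset.sum_add_distrib]
        congr 1
        · simp only [Finset.sum_const, nsmul_eq_mul, Finset.card_univ, Fintype.card_fun,
            Fintype.card_fin, Nat.cast_pow]
          ring
        · rw [Finset.sum_congr rfl fun f _ => Finset.sum_comm]
          exact Finset.sum_comm
    _ ≤ ((m : ℝ) ^ 5 * p ^ 9) ^ 2 + 32 * (((m : ℝ) ^ 5 * p ^ 9) ^ 2 / q) := by
        gcongr
        refine (Finset.sum_le_sum hS).trans ?_
        rw [Finset.sum_const, nsmul_eq_mul]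
        gcongr
        exact_mod_cast (Finset.card_filter_le _ _).trans (by simp)
    _ = (1 + 32 / q) * ((m : ℝ) ^ 5 * p ^ 9) ^ 2 := by ring

lemma partiteCopy_subset {n m : ℕ} (h : 5 * m ≤ n) (f : Fin 5 → Fin m) :
    partiteCopy h f ⊆ completeEdges n := by
  intro e he
  obtain ⟨d, hd, rfl⟩ := Finset.mem_image.1 he
  have hdiag : ∀ d ∈ nearK5, ¬ d.IsDiag := by decide
  simpa [completeEdges, Sym2.isDiag_map (classVertex_injective h f)] using hdiag d hd

lemma oMakerWin_of_partiteCopy {n m : ℕ} (h : 5 * m ≤ n) (f : Fin 5 → Fin m)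
    {A : Finset (Sym2 (Fin n))} (hA : partiteCopy h f ⊆ A) :
    OMakerWin A HasAcyclicTriangle 1 ∅ ∅ := by
  have hmem : ∀ i j, s(i, j) ∈ nearK5 → s(classVertex h i (f i), classVertex h j (f j)) ∈ A :=
    fun i j hij => hA (Finset.mem_image.2 ⟨s(i, j), hij, rfl⟩)
  refine oMakerWin_of_K5_minus_edge (a := classVertex h 0 (f 0)) (b := classVertex h 1 (f 1))
    (c := classVertex h 2 (f 2)) (u := classVertex h 3 (f 3)) (v := classVertex h 4 (f 4)) ?_ ?_
  · simp [classVertex_inj]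
  · simp only [List.forall_mem_cons]
    refine ⟨hmem _ _ ?_, hmem _ _ ?_, hmem _ _ ?_, hmem _ _ ?_, hmem _ _ ?_, hmem _ _ ?_,
      hmem _ _ ?_, hmem _ _ ?_, hmem _ _ ?_, by simp⟩ <;> decide

lemma edgeProb_oMakerWin_ge {n m : ℕ} (h : 5 * m ≤ n) (hm : 1 ≤ m) {p : ℝ} (hp0 : 0 ≤ p)
    (hp1 : p ≤ 1) (hq : 1 ≤ p * (m : ℝ) ^ (5 / 9 : ℝ)) :
    1 - 32 / (p * (m : ℝ) ^ (5 / 9 : ℝ)) ≤ edgeProb (completeEdges n) p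
      (fun A => OMakerWin A HasAcyclicTriangle 1 ∅ ∅) := by
  have hm0 : (0 : ℝ) < m := by exact_mod_cast hm
  have hp : 0 < p := by
    rcases hp0.eq_or_lt with rfl | h
    · norm_num at hq
    · exact h
  have hμ0 : 0 < (m : ℝ) ^ 5 * p ^ 9 := by positivity
  have hbound := two_sub_le_edgeProb (E := completeEdges n) hp0 hp1
    (P := fun A => OMakerWin A HasAcyclicTriangle 1 ∅ ∅)
    (Finset.univ : Finset (Fin 5 → Fin m)) (partiteCopy h)
    (fun f _ => partiteCopy_subset h f) (fun A _ f _ hf => oMakerWin_of_partiteCopy h f hf)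
    (μ := (m : ℝ) ^ 5 * p ^ 9) (by simp [card_partiteCopy]) hμ0
  have hsum := sum_pow_card_union_le h hm hp0 hp1 hq
  have := (div_le_iff₀ (by positivity)).2 hsum
  linarith

/-- `n^{-5/9}` is the threshold probability for the unbiased
`T_A`-tournament game (acyclic triangle) on `G_{n,p}`. -/
theorem acyclic_triangle_threshold_probability
    (p : ℕ → ℝ) (hp0 : ∀ n, 0 ≤ p n) (hp1 : ∀ n, p n ≤ 1) :
    (Filter.Tendsto (fun n : ℕ => p n * (n : ℝ) ^ (5 / 9 : ℝ))
        Filter.atTop Filter.atTop →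
      Filter.Tendsto (fun n : ℕ => edgeProb (completeEdges n) (p n)
          (fun A => OMakerWin A HasAcyclicTriangle 1 ∅ ∅)) Filter.atTop (nhds 1)) ∧
    (Filter.Tendsto (fun n : ℕ => p n * (n : ℝ) ^ (5 / 9 : ℝ))
        Filter.atTop (nhds 0) →
      Filter.Tendsto (fun n : ℕ => edgeProb (completeEdges n) (p n)
          (fun A => OBreakerBlock A HasAcyclicTriangle 1 ∅ ∅)) Filter.atTop (nhds 1)) := by
  constructor
  · intro hp
    have hm : ∀ᶠ n : ℕ in Filter.atTop,
        p n * (n : ℝ) ^ (5 / 9 : ℝ) / 10 ≤ p n * ((n / 5 : ℕ) : ℝ) ^ (5 / 9 : ℝ) := by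
      filter_upwards [Filter.eventually_ge_atTop 5] with n hn
      have h1 : (n : ℝ) ≤ 10 * ((n / 5 : ℕ) : ℝ) := by
        exact_mod_cast (show n ≤ 10 * (n / 5) by omega)
      have h2 : (n : ℝ) ^ (5 / 9 : ℝ) ≤ 10 * ((n / 5 : ℕ) : ℝ) ^ (5 / 9 : ℝ) := by
        refine (Real.rpow_le_rpow (by positivity) h1 (by norm_num)).trans ?_
        rw [Real.mul_rpow (by norm_num) (by positivity)]
        refine mul_le_mul_of_nonneg_right ?_ (by positivity)
        exact Real.rpow_le_self_of_one_le (by norm_num) (by norm_num)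
      calc p n * (n : ℝ) ^ (5 / 9 : ℝ) / 10
          ≤ p n * (10 * ((n / 5 : ℕ) : ℝ) ^ (5 / 9 : ℝ)) / 10 := by
            gcongr
            exact hp0 n
        _ = p n * ((n / 5 : ℕ) : ℝ) ^ (5 / 9 : ℝ) := by ring
    have hq : Filter.Tendsto (fun n : ℕ => p n * ((n / 5 : ℕ) : ℝ) ^ (5 / 9 : ℝ))
        Filter.atTop Filter.atTop :=
      Filter.tendsto_atTop_mono' _ hm (hp.atTop_div_const (by norm_num))
    have hlow : Filter.Tendsto
        (fun n : ℕ => 1 - 32 / (p n * ((n / 5 : ℕ) : ℝ) ^ (5 / 9 : ℝ))) Filter.atTop (nhds 1) := by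
      simpa using (hq.const_div_atTop 32).const_sub 1
    refine tendsto_of_tendsto_of_tendsto_of_le_of_le' hlow tendsto_const_nhds ?_
      (Filter.Eventually.of_forall fun n => edgeProb_le_one (hp0 n) (hp1 n) _)
    filter_upwards [hq.eventually_ge_atTop 1, Filter.eventually_ge_atTop 5] with n hn hn5
    exact edgeProb_oMakerWin_ge (by omega) (by omega) (hp0 n) (hp1 n) hn
  · intro hp
    have hlow : Filter.Tendsto
        (fun n : ℕ => 1 - 15 * 2 ^ 120 * (p n * (n : ℝ) ^ (5 / 9 : ℝ)))
        Filter.atTop (nhds 1) := by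
      simpa using (hp.const_mul (15 * 2 ^ 120)).const_sub 1
    refine tendsto_of_tendsto_of_tendsto_of_le_of_le' hlow tendsto_const_nhds ?_
      (Filter.Eventually.of_forall fun n => edgeProb_le_one (hp0 n) (hp1 n) _)
    filter_upwards [hp.eventually_le_const zero_lt_one, Filter.eventually_ge_atTop 1]
      with n hn hn1
    refine (edgeProb_locallySparse_ge hn1 (hp0 n) (hp1 n) hn).trans ?_
    refine edgeProb_mono (hp0 n) (hp1 n) fun A hA hsparse => hsparse.oBreakerBlock ?_
    exact fun e he => (Finset.mem_filter.1 (hA he)).2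

end TournamentGame
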